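/- There exists an absolute constant C > 1 such that the following holds, where A is an absolute constant (one may take A ≤ e²√6). For every δ > 0 there exists n₀ such that for all n ≥ n₀, all ε, p ∈ (0,1) with ε³np² ≥ A²C and p < 1 − 15√ε, and every weakly (p, A√(np))-bijumbled graph G of order n: if an orientation D of G is chosen uniformly at random among the 2^{e(G)} orientations of G, then D contains a Seymour vertex with probability at least 1 − δ. -/

import Mathlib

/-- `D` is an orientation of the simple graph `G`: every arc of `D` lies on an edge of `G`,
and every edge of `G` is given exactly one of its two possible directions. -/
def IsOrientation {V : Type*} (G : SimpleGraph V) (D : V → V → Prop) : Prop :=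
  (∀ u v, D u v → G.Adj u v) ∧ ∀ u v, G.Adj u v → (D u v ↔ ¬ D v u)

/-- The first neighborhood (out-neighborhood) of `u` in the digraph `D`. -/
def firstNbhd {V : Type*} (D : V → V → Prop) (u : V) : Set V := {v | D u v}

/-- The second neighborhood of `u`: vertices whose shortest directed path from `u`
has exactly two arcs. -/
def secondNbhd {V : Type*} (D : V → V → Prop) (u : V) : Set V :=
  {v | ¬ D u v ∧ v ≠ u ∧ ∃ w, D u w ∧ D w v}

/-- A Seymour vertex: its second neighborhood is at least as large as its first. -/
def IsSeymourVertex {V : Type*} (D : V → V → Prop) (u : V) : Prop :=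
  (firstNbhd D u).ncard ≤ (secondNbhd D u).ncard

/-- The digraph `D` contains a Seymour vertex. -/
def HasSeymourVertex {V : Type*} (D : V → V → Prop) : Prop :=
  ∃ u, IsSeymourVertex D u

/-- The number of edges of `G` with both endpoints in `X`. -/
noncomputable def edgesIn {V : Type*} (G : SimpleGraph V) (X : Set V) : ℕ :=
  {e ∈ G.edgeSet | ∀ v ∈ e, v ∈ X}.ncard

/-- The number of edges of `G` with one endpoint in `X` and the other in `Y`. -/
noncomputable def edgesBetween {V : Type*} (G : SimpleGraph V) (X Y : Set V) : ℕ :=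
  {e ∈ G.edgeSet | ∃ x ∈ X, ∃ y ∈ Y, e = s(x, y)}.ncard

/-- A graph `G` of order `n` is weakly `(p, α)`-bijumbled if all pairs of disjoint sets
`U`, `W` with `1 ≤ |U| ≤ |W| ≤ np|U|` satisfy `|e(U,W) − p|U||W|| ≤ α √(|U||W|)`. -/
def WeaklyBijumbled {V : Type*} [Fintype V] (G : SimpleGraph V) (p α : ℝ) : Prop :=
  ∀ U W : Set V, Disjoint U W → 1 ≤ U.ncard → U.ncard ≤ W.ncard →
    (W.ncard : ℝ) ≤ (Fintype.card V : ℝ) * p * U.ncard →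
    |(edgesBetween G U W : ℝ) - p * U.ncard * W.ncard| ≤
      α * Real.sqrt (U.ncard * W.ncard)

/-- The probability that an orientation of `G`, chosen uniformly at random among the
`2^{e(G)}` orientations of `G`, belongs to the set `S`. -/
noncomputable def orientProb {V : Type*} (G : SimpleGraph V) (S : Set (V → V → Prop)) : ℝ :=
  (Nat.card {D : V → V → Prop // IsOrientation G D ∧ D ∈ S} : ℝ) / 2 ^ G.edgeSet.ncard

section Helpers
open Classical Finset

/-- The orientation encoded by a choice of one bit for every edge. -/
def bitD {n : ℕ} (G : SimpleGraph (Fin n)) (f : G.edgeSet → Bool) (u v : Fin n) : Prop :=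
  ∃ h : G.Adj u v, f ⟨s(u, v), h⟩ = decide (u < v)

lemma bitD_edge_eq {n : ℕ} {G : SimpleGraph (Fin n)} {u v : Fin n} (h : G.Adj u v)
    (h' : G.Adj v u) :
    (⟨s(v, u), h'⟩ : G.edgeSet) = ⟨s(u, v), h⟩ := Subtype.ext Sym2.eq_swap

lemma bitD_isOrientation {n : ℕ} (G : SimpleGraph (Fin n)) (f : G.edgeSet → Bool) :
    IsOrientation G (bitD G f) := by
  refine ⟨fun u v h => h.1, fun u v h => ?_⟩
  have hne : u ≠ v := h.ne
  unfold bitD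
  constructor
  · rintro ⟨h1, h2⟩ ⟨h3, h4⟩
    rw [bitD_edge_eq h h3, h2] at h4
    have := decide_eq_decide.mp h4
    have h5 : u < v ∨ v < u := lt_or_gt_of_ne hne
    rcases h5 with h5 | h5
    · exact absurd (this.1 h5) (not_lt.2 h5.le)
    · exact absurd (this.2 h5) (not_lt.2 h5.le)
  · intro h1
    refine ⟨h, ?_⟩
    by_contra h2
    apply h1
    refine ⟨h.symm, ?_⟩
    rw [bitD_edge_eq h h.symm]
    have h3 : f ⟨s(u, v), h⟩ = !decide (u < v) := by
      cases hh : f ⟨s(u, v), h⟩ <;> cases hd : decide (u < v) <;> simp_all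
    rw [h3]
    rcases lt_or_gt_of_ne hne with h5 | h5
    · simp [h5, h5.le]
    · simp [h5, h5.le]

lemma bitD_injective {n : ℕ} (G : SimpleGraph (Fin n)) : Function.Injective (bitD G) := by
  intro f g hfg
  funext ⟨e, he⟩
  induction e using Sym2.ind with
  | _ u v =>
    have h1 : bitD G f u v ↔ bitD G g u v := by rw [hfg]
    have hadj : G.Adj u v := he
    have h2 : f ⟨s(u, v), hadj⟩ = decide (u < v) ↔ g ⟨s(u, v), hadj⟩ = decide (u < v) :=
      ⟨fun h => (h1.1 ⟨hadj, h⟩).2, fun h => (h1.2 ⟨hadj, h⟩).2⟩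
    show f ⟨s(u, v), hadj⟩ = g ⟨s(u, v), hadj⟩
    revert h2
    cases f ⟨s(u, v), hadj⟩ <;> cases g ⟨s(u, v), hadj⟩ <;> cases decide (u < v) <;> simp

/-- It suffices to count bit assignments. -/
lemma orientProb_ge {n : ℕ} (G : SimpleGraph (Fin n)) (S : Set (Fin n → Fin n → Prop)) :
    ((univ.filter fun f : G.edgeSet → Bool => bitD G f ∈ S).card : ℝ) /
      2 ^ Fintype.card G.edgeSet ≤ orientProb G S := by
  unfold orientProb
  have h1 : G.edgeSet.ncard = Fintype.card G.edgeSet := by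
    rw [← Nat.card_coe_set_eq, Nat.card_eq_fintype_card]
  rw [h1]
  gcongr
  rw [← Fintype.card_subtype, ← Nat.card_eq_fintype_card]
  exact Nat.card_le_card_of_injective
    (fun f : {f : G.edgeSet → Bool // bitD G f ∈ S} =>
      (⟨bitD G f.1, bitD_isOrientation G f.1, f.2⟩ :
        {D : Fin n → Fin n → Prop // IsOrientation G D ∧ D ∈ S}))
    (fun f g h => Subtype.ext (bitD_injective G (congrArg Subtype.val h)))

lemma card_agree {ι : Type*} [Fintype ι] (F : Finset ι) (g : ι → Bool) :
    (univ.filter fun f : ι → Bool => ∀ e ∈ F, f e = g e).card * 2 ^ F.card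
      = 2 ^ Fintype.card ι := by
  have h1 : (univ.filter fun f : ι → Bool => ∀ e ∈ F, f e = g e) =
      Fintype.piFinset (fun e => if e ∈ F then {g e} else (univ : Finset Bool)) := by
    ext f
    simp only [mem_filter, mem_univ, true_and, Fintype.mem_piFinset]
    refine forall_congr' fun e => ?_
    by_cases he : e ∈ F <;> simp [he]
  rw [h1, Fintype.card_piFinset]
  have h2 : ∀ e : ι, (if e ∈ F then {g e} else (univ : Finset Bool)).card
      = if e ∈ F then 1 else 2 := by
    intro e; by_cases he : e ∈ F <;> simp [he]
  rw [prod_congr rfl (fun e _ => h2 e), prod_ite]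
  simp only [prod_const, one_pow, one_mul]
  rw [← pow_add]
  congr 1
  have := card_filter_add_card_filter_not (s := (univ : Finset ι)) (fun e => e ∈ F)
  simp at this ⊢
  omega

/-- Edges between disjoint finite sets, counted as adjacent pairs. -/
lemma edgesBetween_eq {n : ℕ} (G : SimpleGraph (Fin n)) (U W : Finset (Fin n))
    (h : Disjoint U W) :
    edgesBetween G U W = ∑ u ∈ U, (W.filter fun w => G.Adj u w).card := by
  have h0 : ∑ u ∈ U, (W.filter fun w => G.Adj u w).card
      = ((U ×ˢ W).filter fun q => G.Adj q.1 q.2).card := by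
    rw [card_filter, sum_product]
    simp only [card_filter]
  have h1 : {e ∈ G.edgeSet | ∃ x ∈ (U : Set (Fin n)), ∃ y ∈ (W : Set (Fin n)), e = s(x, y)} =
      (((U ×ˢ W).filter fun q => G.Adj q.1 q.2).image (fun q => s(q.1, q.2)) :
        Finset (Sym2 (Fin n))) := by
    ext e
    simp only [Set.mem_ofPred_eq, coe_image, Set.mem_image, mem_coe, mem_filter, mem_product]
    constructor
    · rintro ⟨he, x, hx, y, hy, rfl⟩
      exact ⟨(x, y), ⟨⟨hx, hy⟩, he⟩, rfl⟩
    · rintro ⟨⟨x, y⟩, ⟨⟨hx, hy⟩, ha⟩, rfl⟩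
      exact ⟨ha, x, hx, y, hy, rfl⟩
  unfold edgesBetween
  rw [h1, Set.ncard_coe_finset, h0, card_image_of_injOn]
  rintro ⟨x, y⟩ hq ⟨x', y'⟩ hq' he
  simp only [coe_filter, mem_product, Set.mem_ofPred_eq] at hq hq'
  rw [disjoint_left] at h
  simp only [Sym2.eq_iff] at he
  rcases he with ⟨rfl, rfl⟩ | ⟨rfl, rfl⟩
  · rfl
  · exact absurd hq'.1.2 (h hq.1.1)

/-- Number of bit assignments with no arc from `U` to `W`. -/
lemma card_noArc {n : ℕ} (G : SimpleGraph (Fin n)) (U W : Finset (Fin n)) :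
    (univ.filter fun f : G.edgeSet → Bool => ∀ x ∈ U, ∀ y ∈ W, ¬ bitD G f x y).card *
      2 ^ edgesBetween G U W ≤ 2 ^ Fintype.card G.edgeSet := by
  set B := univ.filter fun f : G.edgeSet → Bool => ∀ x ∈ U, ∀ y ∈ W, ¬ bitD G f x y with hB
  rcases B.eq_empty_or_nonempty with h | ⟨f0, hf0⟩
  · simp [h]
  set F : Finset G.edgeSet := univ.filter fun e => ∃ x ∈ U, ∃ y ∈ W, e.1 = s(x, y) with hF
  have hc : edgesBetween G U W = F.card := by
    unfold edgesBetween
    rw [← card_image_of_injective F Subtype.val_injective, ← Set.ncard_coe_finset]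
    congr 1
    ext e
    simp only [hF, Set.mem_ofPred_eq, coe_image, Set.mem_image, mem_coe, mem_filter, mem_univ,
      true_and]
    constructor
    · rintro ⟨he, hx⟩
      exact ⟨⟨e, he⟩, hx, rfl⟩
    · rintro ⟨e, hx, rfl⟩
      exact ⟨e.2, hx⟩
  rw [hc, ← card_agree F f0]
  gcongr
  intro f hf
  simp only [mem_filter, mem_univ, true_and, hF, hB] at hf hf0 ⊢
  rintro ⟨e, he⟩ ⟨x, hx, y, hy, rfl⟩
  have hadj : G.Adj x y := he
  have h1 : f ⟨s(x, y), hadj⟩ ≠ decide (x < y) := fun h => hf x hx y hy ⟨hadj, h⟩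
  have h2 : f0 ⟨s(x, y), hadj⟩ ≠ decide (x < y) := fun h => hf0 x hx y hy ⟨hadj, h⟩
  revert h1 h2
  cases f ⟨s(x, y), hadj⟩ <;> cases f0 ⟨s(x, y), hadj⟩ <;> cases decide (x < y) <;> simp

/-- The sign of the pair `u w`. -/
noncomputable def sgn {n : ℕ} (G : SimpleGraph (Fin n)) (f : G.edgeSet → Bool)
    (u w : Fin n) : ℝ := if bitD G f u w then 1 else -1

lemma sgn_cross {n : ℕ} (G : SimpleGraph (Fin n)) (u w w' : Fin n) (hw : G.Adj u w)
    (hne : w ≠ w') :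
    ∑ f : G.edgeSet → Bool, sgn G f u w * sgn G f u w' = 0 := by
  set e0 : G.edgeSet := ⟨s(u, w), hw⟩ with he0
  let φ : (G.edgeSet → Bool) → (G.edgeSet → Bool) := fun f => Function.update f e0 (!f e0)
  have hφ : Function.Involutive φ := by
    intro f
    simp [φ]
  have h1 : ∀ f, sgn G (φ f) u w = - sgn G f u w := by
    intro f
    have : bitD G (φ f) u w ↔ ¬ bitD G f u w := by
      unfold bitD
      simp only [hw, exists_true_left, φ, ← he0, Function.update_self]
      cases f e0 <;> cases decide (u < w) <;> simp
    unfold sgn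
    by_cases hb : bitD G f u w <;> simp [this, hb]
  have h2 : ∀ f, sgn G (φ f) u w' = sgn G f u w' := by
    intro f
    have : bitD G (φ f) u w' ↔ bitD G f u w' := by
      unfold bitD
      refine exists_congr fun h => ?_
      have : (⟨s(u, w'), h⟩ : G.edgeSet) ≠ e0 := by
        intro h'
        have h3 := congrArg Subtype.val h'
        simp only [he0] at h3
        rw [Sym2.eq_iff] at h3
        rcases h3 with h3 | h3
        · exact hne h3.2.symm
        · exact hw.ne h3.1
      simp only [φ, Function.update_of_ne this]
    unfold sgn
    simp [this]
  have h3 := Equiv.sum_comp (hφ.toPerm φ) (fun f => sgn G f u w * sgn G f u w')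
  simp only [Function.Involutive.coe_toPerm, h1, h2, neg_mul, sum_neg_distrib] at h3
  linarith

lemma sgn_second_moment {n : ℕ} (G : SimpleGraph (Fin n)) (u : Fin n) :
    ∑ f : G.edgeSet → Bool, (∑ w ∈ univ.filter (G.Adj u), sgn G f u w) ^ 2
      = (univ.filter (G.Adj u)).card * 2 ^ Fintype.card G.edgeSet := by
  have h1 : ∀ w ∈ univ.filter (G.Adj u), ∀ w' ∈ univ.filter (G.Adj u),
      ∑ f : G.edgeSet → Bool, sgn G f u w * sgn G f u w' =
        if w = w' then (2 : ℝ) ^ Fintype.card G.edgeSet else 0 := by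
    intro w hw w' hw'
    simp only [mem_filter, mem_univ, true_and] at hw
    by_cases h : w = w'
    · subst h
      have : ∀ f, sgn G f u w * sgn G f u w = 1 := by
        intro f; unfold sgn; split_ifs <;> norm_num
      simp [this]
    · rw [if_neg h, sgn_cross G u w w' hw h]
  calc _ = ∑ f : G.edgeSet → Bool, ∑ w ∈ univ.filter (G.Adj u), ∑ w' ∈ univ.filter (G.Adj u),
        sgn G f u w * sgn G f u w' := by
        refine sum_congr rfl fun f _ => ?_
        rw [sq, sum_mul_sum]
    _ = ∑ w ∈ univ.filter (G.Adj u), ∑ w' ∈ univ.filter (G.Adj u), ∑ f : G.edgeSet → Bool,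
        sgn G f u w * sgn G f u w' := by
        rw [sum_comm]
        refine sum_congr rfl fun w _ => ?_
        rw [sum_comm]
    _ = ∑ w ∈ univ.filter (G.Adj u), ∑ w' ∈ univ.filter (G.Adj u),
        if w = w' then (2 : ℝ) ^ Fintype.card G.edgeSet else 0 :=
        sum_congr rfl fun w hw => sum_congr rfl fun w' hw' => h1 w hw w' hw'
    _ = _ := by
        rw [sum_congr rfl (fun w hw => by rw [sum_ite_eq, if_pos hw])]
        simp

lemma sum_sgn {n : ℕ} (G : SimpleGraph (Fin n)) (u : Fin n) (f : G.edgeSet → Bool) :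
    ∑ w ∈ univ.filter (G.Adj u), sgn G f u w =
      2 * ((univ.filter (bitD G f u)).card : ℝ) - (univ.filter (G.Adj u)).card := by
  have h1 : univ.filter (bitD G f u) = (univ.filter (G.Adj u)).filter (bitD G f u) := by
    ext w
    simp only [mem_filter, mem_univ, true_and]
    exact ⟨fun h => ⟨h.1, h⟩, fun h => h.2⟩
  have h2 : ∀ w, sgn G f u w = 2 * (if bitD G f u w then 1 else 0) - 1 := by
    intro w; unfold sgn; split_ifs <;> norm_num
  rw [h1]
  simp only [h2, sum_sub_distrib, ← mul_sum, sum_boole, sum_const, nsmul_eq_mul, mul_one]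

/-- The Chebyshev inequality for the out-degree. -/
lemma card_dev {n : ℕ} (G : SimpleGraph (Fin n)) (u : Fin n) (M : ℝ)
    (hd : 0 < (univ.filter (G.Adj u)).card) :
    ((univ.filter fun f : G.edgeSet → Bool =>
      M * (univ.filter (G.Adj u)).card ≤
        (2 * ((univ.filter (bitD G f u)).card : ℝ) - (univ.filter (G.Adj u)).card) ^ 2).card : ℝ)
      * M ≤ 2 ^ Fintype.card G.edgeSet := by
  have h1 := sgn_second_moment G u
  simp only [sum_sgn] at h1
  set d : ℝ := ((univ.filter (G.Adj u)).card : ℝ) with hdd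
  have hd' : 0 < d := by rw [hdd]; exact_mod_cast hd
  set B := univ.filter fun f : G.edgeSet → Bool =>
      M * d ≤ (2 * ((univ.filter (bitD G f u)).card : ℝ) - d) ^ 2 with hB
  have h2 : (B.card : ℝ) * (M * d) ≤ d * 2 ^ Fintype.card G.edgeSet := by
    rw [← h1, ← nsmul_eq_mul]
    calc B.card • (M * d) ≤ ∑ f ∈ B, (2 * ((univ.filter (bitD G f u)).card : ℝ) - d) ^ 2 := by
          apply card_nsmul_le_sum
          intro f hf
          exact (mem_filter.1 hf).2
      _ ≤ _ := sum_le_sum_of_subset_of_nonneg (subset_univ _) (fun _ _ _ => sq_nonneg _)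
  nlinarith


/-- Numerical consequences of the hypotheses. -/
lemma num_facts {n A p ε : ℝ} (hA : 1 ≤ A) (hn : 0 ≤ n) (hp : 0 < p) (hp1 : p < 1) (hε : 0 < ε)
    (hε1 : ε < 1) (H : A ^ 2 * 1000 ≤ ε ^ 3 * n * p ^ 2) :
    1000 * A ^ 2 ≤ ε * n * p ^ 2 ∧ 1000 * A ^ 2 ≤ ε * n * p ∧ 1000 * A ^ 2 ≤ ε ^ 2 * n ∧
      1000 * A ^ 2 ≤ ε * n ∧ 1000 * A ^ 2 ≤ ε ^ 3 * n ∧ 1000 * A ^ 2 ≤ n * p ^ 2 ∧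
      1000 ≤ 1000 * A ^ 2 := by
  have e2 : ε ^ 2 ≤ 1 := pow_le_one₀ hε.le hε1.le
  have e3 : ε ^ 3 ≤ 1 := pow_le_one₀ hε.le hε1.le
  have p2 : p ^ 2 ≤ 1 := pow_le_one₀ hp.le hp1.le
  have a2 : 1 ≤ A ^ 2 := one_le_pow₀ hA
  have h1 : 1000 * A ^ 2 ≤ ε * n * p ^ 2 := by
    have : ε ^ 2 * (ε * n * p ^ 2) ≤ 1 * (ε * n * p ^ 2) := by gcongr
    nlinarith
  have h2 : ε * n * p ^ 2 ≤ ε * n * p := by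
    have : ε * n * p * p ≤ ε * n * p * 1 := by gcongr
    nlinarith
  have h5 : 1000 * A ^ 2 ≤ ε ^ 3 * n := by
    have : ε ^ 3 * n * p ^ 2 ≤ ε ^ 3 * n * 1 := by gcongr
    nlinarith
  have h3 : 1000 * A ^ 2 ≤ ε ^ 2 * n := by
    have : ε ^ 2 * n * ε ≤ ε ^ 2 * n * 1 := by gcongr
    nlinarith
  have h4 : 1000 * A ^ 2 ≤ ε * n := by
    have : ε * n * ε ≤ ε * n * 1 := by gcongr
    nlinarith
  have h6 : 1000 * A ^ 2 ≤ n * p ^ 2 := by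
    have : ε * (n * p ^ 2) ≤ 1 * (n * p ^ 2) := by gcongr
    nlinarith
  exact ⟨h1, h1.trans h2, h3, h4, h5, h6, by linarith⟩

lemma jumble_finset {n : ℕ} {G : SimpleGraph (Fin n)} {p α : ℝ} (hG : WeaklyBijumbled G p α)
    (U W : Finset (Fin n)) (h : Disjoint U W) (h1 : 1 ≤ U.card) (h2 : U.card ≤ W.card)
    (h3 : (W.card : ℝ) ≤ n * p * U.card) :
    |(edgesBetween G U W : ℝ) - p * U.card * W.card| ≤ α * Real.sqrt (U.card * W.card) := by
  have := hG (U : Set (Fin n)) (W : Set (Fin n)) (by simpa using h)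
  simp only [Set.ncard_coe_finset, Fintype.card_fin] at this
  exact this h1 h2 h3

lemma edgesBetween_symm {n : ℕ} (G : SimpleGraph (Fin n)) (U W : Set (Fin n)) :
    edgesBetween G U W = edgesBetween G W U := by
  unfold edgesBetween
  congr 1
  ext e
  simp only [Set.mem_ofPred_eq]
  constructor
  · rintro ⟨h, x, hx, y, hy, rfl⟩
    exact ⟨h, y, hy, x, hx, Sym2.eq_swap⟩
  · rintro ⟨h, x, hx, y, hy, rfl⟩
    exact ⟨h, y, hy, x, hx, Sym2.eq_swap⟩

lemma jumble_sqrt {A n p a b t : ℝ} (hA : 0 ≤ A) (hn : 0 ≤ n * p)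
    (ht : 0 ≤ t) (h : A ^ 2 * (n * p * (a * b)) ≤ t ^ 2) :
    A * Real.sqrt (n * p) * Real.sqrt (a * b) ≤ t := by
  rw [mul_assoc, ← Real.sqrt_mul hn]
  have : A * Real.sqrt (n * p * (a * b)) = Real.sqrt (A ^ 2 * (n * p * (a * b))) := by
    rw [Real.sqrt_mul (sq_nonneg A), Real.sqrt_sq hA]
  rw [this]
  exact Real.sqrt_le_iff.2 ⟨ht, h⟩

/-- A vertex whose degree is close to `np`. -/
lemma good_vertex {n : ℕ} {G : SimpleGraph (Fin n)} {A p ε s : ℝ} (hA : 1 ≤ A)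
    (hp : 0 < p) (hp1 : p < 1) (hε : 0 < ε) (hs : 0 < s) (hs2 : s ^ 2 = ε) (hs15 : s < 1 / 15)
    (H : A ^ 2 * 1000 ≤ ε ^ 3 * n * p ^ 2)
    (hG : WeaklyBijumbled G p (A * Real.sqrt (n * p))) :
    ∃ u : Fin n, n * p / 2 ≤ ((univ.filter (G.Adj u)).card : ℝ) ∧
      ((univ.filter (G.Adj u)).card : ℝ) ≤ n * p + 2 * (ε * n) + s * n := by
  have hε225 : ε < 1 / 225 := by rw [← hs2]; nlinarith
  obtain ⟨f1, f2, f3, f4, f5, f6, f7⟩ := num_facts hA (Nat.cast_nonneg n) hp hp1 hε (by linarith) H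
  have hn0 : (0 : ℝ) < n := by
    by_contra h
    have : (n : ℝ) = 0 := le_antisymm (not_lt.1 h) (Nat.cast_nonneg n)
    rw [this] at f4
    linarith
  obtain ⟨k, hk⟩ : ∃ k : ℕ, k = ⌈ε * n⌉₊ := ⟨_, rfl⟩
  have hk1 : ε * n ≤ k := hk ▸ Nat.le_ceil _
  have hk2 : (k : ℝ) ≤ 2 * (ε * n) := by
    have : (k : ℝ) < ε * n + 1 := hk ▸ Nat.ceil_lt_add_one (by positivity)
    linarith
  have hkn : (k : ℝ) ≤ n / 100 := by nlinarith
  have hk0 : (0 : ℝ) < k := by linarith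
  have hkpos : 1 ≤ k := by exact_mod_cast hk0
  have hkn' : 100 * k ≤ n := by
    have : (100 : ℝ) * k ≤ n := by linarith
    exact_mod_cast this
  -- the estimate for all sets of size `k`
  have key : ∀ U : Finset (Fin n), U.card = k →
      |(edgesBetween G U (Uᶜ : Finset (Fin n)) : ℝ) - p * k * (n - k)| ≤
        A * Real.sqrt (n * p) * Real.sqrt (k * (n - k)) := by
    intro U hU
    have hc : (Uᶜ).card = n - k := by rw [card_compl, Fintype.card_fin, hU]
    have hc' : ((Uᶜ).card : ℝ) = n - k := by rw [hc, Nat.cast_sub (by omega)]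
    have := jumble_finset hG U Uᶜ disjoint_compl_right (by omega) (by omega) (by
      rw [hc', hU]
      have : (n : ℝ) * 1 ≤ n * (p * k) := by
        gcongr
        nlinarith
      nlinarith)
    rw [hc', hU] at this
    exact this
  have hnk : (0 : ℝ) ≤ n - k := by linarith
  have sq1 : A * Real.sqrt (n * p) * Real.sqrt (k * (n - k)) ≤ k * (s * n) := by
    apply jumble_sqrt (by linarith) (by positivity) (by positivity)
    have h1 : A ^ 2 * p ≤ k * ε := by nlinarith [sq_nonneg A]
    calc A ^ 2 * (n * p * (k * (n - k))) ≤ A ^ 2 * (n * p * (k * n)) := by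
          gcongr; linarith
      _ = (A ^ 2 * p) * (k * n ^ 2) := by ring
      _ ≤ (k * ε) * (k * n ^ 2) := by gcongr
      _ = _ := by rw [← hs2]; ring
  have sq2 : A * Real.sqrt (n * p) * Real.sqrt (k * (n - k)) ≤ k * (n * p / 4) := by
    apply jumble_sqrt (by linarith) (by positivity) (by positivity)
    have h1 : 16 * A ^ 2 ≤ k * p := by nlinarith [sq_nonneg A]
    calc A ^ 2 * (n * p * (k * (n - k))) ≤ A ^ 2 * (n * p * (k * n)) := by
          gcongr; linarith
      _ = (16 * A ^ 2) * (k * n ^ 2 * p / 16) := by ring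
      _ ≤ (k * p) * (k * n ^ 2 * p / 16) := by gcongr
      _ = _ := by ring
  set L := univ.filter fun u : Fin n => ((univ.filter (G.Adj u)).card : ℝ) < n * p / 2 with hL
  set Hs := univ.filter fun u : Fin n =>
    n * p + 2 * (ε * n) + s * n < ((univ.filter (G.Adj u)).card : ℝ) with hHs
  have hLk : L.card < k := by
    by_contra hcon
    obtain ⟨U, hUL, hU⟩ := exists_subset_card_eq (not_lt.1 hcon)
    have h1 := key U hU
    rw [edgesBetween_eq G U Uᶜ disjoint_compl_right] at h1
    have h2 := (abs_le.1 (h1.trans sq2)).1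
    have h3 : ((∑ u ∈ U, (Uᶜ.filter fun w => G.Adj u w).card : ℕ) : ℝ) ≤ k * (n * p / 2) := by
      rw [← hU, ← nsmul_eq_mul]
      push_cast
      apply sum_le_card_nsmul
      intro u hu
      have h4 := (mem_filter.1 (hUL hu)).2
      refine le_trans ?_ h4.le
      exact_mod_cast card_le_card (filter_subset_filter _ (subset_univ _))
    have h5 : k * (n * p / 2) + k * (n * p / 4) < p * k * (n - k) := by
      have : 0 < p * k := by positivity
      nlinarith
    linarith
  have hHk : Hs.card < k := by
    by_contra hcon
    obtain ⟨U, hUL, hU⟩ := exists_subset_card_eq (not_lt.1 hcon)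
    have h1 := key U hU
    rw [edgesBetween_eq G U Uᶜ disjoint_compl_right] at h1
    have h2 := (abs_le.1 (h1.trans sq1)).2
    have h3 : k * (n * p + 2 * (ε * n) + s * n - k) ≤
        ((∑ u ∈ U, (Uᶜ.filter fun w => G.Adj u w).card : ℕ) : ℝ) := by
      nth_rewrite 1 [← hU]
      rw [← nsmul_eq_mul]
      push_cast
      apply card_nsmul_le_sum
      intro u hu
      have h4 := (mem_filter.1 (hUL hu)).2
      have h5 : (univ.filter (G.Adj u)).card ≤ (Uᶜ.filter fun w => G.Adj u w).card + k := by
        rw [← hU]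
        refine (card_le_card ?_).trans (card_union_le _ _)
        intro w hw
        simp only [mem_filter, mem_univ, true_and, mem_union, mem_compl] at hw ⊢
        tauto
      have h5' : ((univ.filter (G.Adj u)).card : ℝ) ≤
        (Uᶜ.filter fun w => G.Adj u w).card + k := by exact_mod_cast h5
      linarith
    have h6 : p * k * (n - k) + k * (s * n) < k * (n * p + 2 * (ε * n) + s * n - k) := by
      have : 0 < p * k * k := by positivity
      nlinarith
    linarith
  have hex : ∃ u, u ∉ L ∪ Hs := by
    by_contra hcon
    push Not at hcon
    have h1 : (L ∪ Hs) = univ := by ext u; simpa using hcon u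
    have h2 := card_union_le L Hs
    rw [h1, card_univ, Fintype.card_fin] at h2
    omega
  obtain ⟨u, hu⟩ := hex
  simp only [hL, hHs, mem_union, mem_filter, mem_univ, true_and, not_or, not_lt] at hu
  exact ⟨u, hu⟩

/-- Between sets of the relevant sizes there are at least `3n` edges. -/
lemma many_edges {n : ℕ} {G : SimpleGraph (Fin n)} {A p ε : ℝ} (hA : 1 ≤ A)
    (hp : 0 < p) (hp1 : p < 1) (hε : 0 < ε) (hε1 : ε < 1)
    (H : A ^ 2 * 1000 ≤ ε ^ 3 * n * p ^ 2)
    (hG : WeaklyBijumbled G p (A * Real.sqrt (n * p)))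
    (U W : Finset (Fin n)) (hd : Disjoint U W) (hU : U.card = ⌈n * p / 8⌉₊)
    (hW : W.card = ⌈ε * n⌉₊) : 3 * n ≤ edgesBetween G U W := by
  obtain ⟨f1, f2, f3, f4, f5, f6, f7⟩ := num_facts hA (Nat.cast_nonneg n) hp hp1 hε hε1 H
  have hn0 : (0 : ℝ) < n := by
    by_contra h
    have : (n : ℝ) = 0 := le_antisymm (not_lt.1 h) (Nat.cast_nonneg n)
    rw [this] at f4
    linarith
  have hnp : 1000 ≤ n * p := by nlinarith
  have hnpn : n * p ≤ n := by nlinarith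
  have hεn : ε * n ≤ n := by nlinarith
  have u1 : n * p / 8 ≤ (U.card : ℝ) := hU ▸ Nat.le_ceil _
  have w1 : ε * n ≤ (W.card : ℝ) := hW ▸ Nat.le_ceil _
  have u2 : (U.card : ℝ) < n * p / 8 + 1 := hU ▸ Nat.ceil_lt_add_one (by positivity)
  have w2 : (W.card : ℝ) < ε * n + 1 := hW ▸ Nat.ceil_lt_add_one (by positivity)
  have hU1 : 1 ≤ U.card := by
    have : (0 : ℝ) < U.card := by linarith
    exact_mod_cast this
  have hW1 : 1 ≤ W.card := by
    have : (0 : ℝ) < W.card := by linarith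
    exact_mod_cast this
  have key : |(edgesBetween G U W : ℝ) - p * U.card * W.card| ≤
      A * Real.sqrt (n * p) * Real.sqrt (U.card * W.card) := by
    rcases le_total U.card W.card with h | h
    · refine jumble_finset hG U W hd hU1 h ?_
      have : n * p * (n * p / 8) ≤ n * p * (U.card : ℝ) := by gcongr
      nlinarith
    · have := jumble_finset hG W U hd.symm hW1 h (by
        have : n * p * (ε * n) ≤ n * p * (W.card : ℝ) := by gcongr
        nlinarith)
      rw [edgesBetween_symm, mul_comm (U.card : ℝ) (W.card : ℝ)]
      convert this using 3
      ring
  set a : ℝ := (U.card : ℝ) with ha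
  set b : ℝ := (W.card : ℝ) with hb
  have ha0 : 0 < a := by linarith
  have hb0 : 0 < b := by linarith
  have hab : 100 * A ^ 2 * n ≤ p * a * b := by
    calc 100 * A ^ 2 * n ≤ (1000 * A ^ 2 / 8) * n := by nlinarith
      _ ≤ (ε * n * p ^ 2 / 8) * n := by gcongr
      _ = p * (n * p / 8) * (ε * n) := by ring
      _ ≤ _ := by gcongr
  have hsq : A * Real.sqrt (n * p) * Real.sqrt (a * b) ≤ p * a * b / 2 := by
    apply jumble_sqrt (by linarith) (by positivity) (by positivity)
    calc A ^ 2 * (n * p * (a * b)) = (A ^ 2 * n) * (p * a * b) := by ring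
      _ ≤ (p * a * b / 4) * (p * a * b) := by
        gcongr
        nlinarith [sq_nonneg A]
      _ = _ := by ring
  have h2 := (abs_le.1 (key.trans hsq)).1
  have h3 : (3 * n : ℝ) ≤ edgesBetween G U W := by nlinarith
  exact_mod_cast h3

lemma card_bad {n : ℕ} {G : SimpleGraph (Fin n)} {A p ε : ℝ} (hA : 1 ≤ A)
    (hp : 0 < p) (hp1 : p < 1) (hε : 0 < ε) (hε1 : ε < 1)
    (H : A ^ 2 * 1000 ≤ ε ^ 3 * n * p ^ 2)
    (hG : WeaklyBijumbled G p (A * Real.sqrt (n * p))) :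
    (univ.filter fun f : G.edgeSet → Bool => ∃ q : Finset (Fin n) × Finset (Fin n),
      (Disjoint q.1 q.2 ∧ q.1.card = ⌈n * p / 8⌉₊ ∧ q.2.card = ⌈ε * n⌉₊) ∧
        ∀ x ∈ q.1, ∀ y ∈ q.2, ¬ bitD G f x y).card * 2 ^ n ≤ 2 ^ Fintype.card G.edgeSet := by
  set Q := univ.filter fun q : Finset (Fin n) × Finset (Fin n) =>
    Disjoint q.1 q.2 ∧ q.1.card = ⌈n * p / 8⌉₊ ∧ q.2.card = ⌈ε * n⌉₊ with hQ
  have h1 : (univ.filter fun f : G.edgeSet → Bool => ∃ q : Finset (Fin n) × Finset (Fin n),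
      (Disjoint q.1 q.2 ∧ q.1.card = ⌈n * p / 8⌉₊ ∧ q.2.card = ⌈ε * n⌉₊) ∧
        ∀ x ∈ q.1, ∀ y ∈ q.2, ¬ bitD G f x y) ⊆
      Q.biUnion fun q => univ.filter fun f : G.edgeSet → Bool =>
        ∀ x ∈ q.1, ∀ y ∈ q.2, ¬ bitD G f x y := by
    intro f hf
    simp only [mem_filter, mem_univ, true_and, mem_biUnion, hQ] at hf ⊢
    exact hf
  have h2 : Q.card ≤ 4 ^ n := by
    refine (card_le_univ Q).trans ?_
    rw [Fintype.card_prod, Fintype.card_finset, Fintype.card_fin, ← mul_pow]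
    norm_num
  have h3 := (card_le_card h1).trans card_biUnion_le
  have h4 : ∀ q ∈ Q, (univ.filter fun f : G.edgeSet → Bool =>
        ∀ x ∈ q.1, ∀ y ∈ q.2, ¬ bitD G f x y).card * 2 ^ (3 * n)
          ≤ 2 ^ Fintype.card G.edgeSet := by
    intro q hq
    simp only [mem_filter, mem_univ, true_and, hQ] at hq
    refine le_trans ?_ (card_noArc G q.1 q.2)
    gcongr
    · norm_num
    · exact many_edges hA hp hp1 hε hε1 H hG q.1 q.2 hq.1 hq.2.1 hq.2.2
  have h5 : (∑ q ∈ Q, (univ.filter fun f : G.edgeSet → Bool =>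
        ∀ x ∈ q.1, ∀ y ∈ q.2, ¬ bitD G f x y).card) * 2 ^ (3 * n) ≤
        4 ^ n * 2 ^ Fintype.card G.edgeSet := by
    rw [sum_mul]
    refine (sum_le_card_nsmul _ _ _ h4).trans ?_
    rw [smul_eq_mul]
    gcongr
  have h6 := (Nat.mul_le_mul_right (2 ^ (3 * n)) h3).trans h5
  have h7 : (2 : ℕ) ^ (3 * n) = 4 ^ n * 2 ^ n := by
    rw [pow_mul, ← mul_pow]; norm_num
  rw [h7] at h6
  refine Nat.le_of_mul_le_mul_left (c := 4 ^ n) ?_ (by positivity)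
  calc _ = _ := by ring
    _ ≤ _ := h6

/-- The deterministic part of the argument. -/
lemma seymour_of_good {n : ℕ} (D : Fin n → Fin n → Prop) (u : Fin n) (a b : ℕ)
    (h1 : a ≤ (univ.filter (D u)).card)
    (h2 : 2 * (univ.filter (D u)).card + 1 + b ≤ n)
    (h3 : ∀ U W : Finset (Fin n), Disjoint U W → U.card = a → W.card = b →
      ∃ x ∈ U, ∃ y ∈ W, D x y) : IsSeymourVertex D u := by
  set N := univ.filter (D u) with hN
  set S := univ.filter fun v => ¬ D u v ∧ v ≠ u ∧ ∃ w, D u w ∧ D w v with hS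
  set R := univ.filter fun v => ¬ D u v ∧ ∀ w, D u w → ¬ D w v with hR
  have hRb : R.card < b := by
    by_contra hcon
    obtain ⟨W, hW, hWc⟩ := exists_subset_card_eq (not_lt.1 hcon)
    obtain ⟨U, hU, hUc⟩ := exists_subset_card_eq h1
    have hdis : Disjoint U W := by
      rw [disjoint_left]
      intro x hx hx'
      exact (mem_filter.1 (hW hx')).2.1 (mem_filter.1 (hU hx)).2
    obtain ⟨x, hx, y, hy, hxy⟩ := h3 U W hdis hUc hWc
    exact (mem_filter.1 (hW hy)).2.2 x (mem_filter.1 (hU hx)).2 hxy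
  have hcov : (univ : Finset (Fin n)) ⊆ ((N ∪ {u}) ∪ R) ∪ S := by
    intro v _
    simp only [hN, hR, hS, mem_union, mem_filter, mem_univ, true_and, mem_singleton]
    by_cases hv : D u v
    · tauto
    by_cases hvu : v = u
    · tauto
    by_cases hw : ∃ w, D u w ∧ D w v
    · tauto
    · push Not at hw
      tauto
  have hc := card_le_card hcov
  have c1 := card_union_le ((N ∪ {u}) ∪ R) S
  have c2 := card_union_le (N ∪ {u}) R
  have c3 := card_union_le N {u}
  rw [card_univ, Fintype.card_fin] at hc
  rw [card_singleton] at c3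
  have e1 : (firstNbhd D u).ncard = N.card := by
    rw [← Set.ncard_coe_finset]; congr 1; ext v; simp [hN, firstNbhd]
  have e2 : (secondNbhd D u).ncard = S.card := by
    rw [← Set.ncard_coe_finset]; congr 1; ext v; simp [hS, secondNbhd]
  unfold IsSeymourVertex
  rw [e1, e2]
  omega

set_option maxHeartbeats 1000000 in
lemma final_num {n d N A p ε s M b : ℝ} (hA : 1 ≤ A) (hn : 0 ≤ n)
    (hp : 0 < p) (hp1 : p < 1) (hε : 0 < ε) (hs : 0 < s) (hs2 : s ^ 2 = ε)
    (hps : p < 1 - 15 * s)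
    (H : A ^ 2 * 1000 ≤ ε ^ 3 * n * p ^ 2)
    (hM : 1 ≤ M) (hnM : M ^ 2 ≤ n)
    (hd1 : n * p / 2 ≤ d) (hd2 : d ≤ n * p + 2 * (ε * n) + s * n) (hdn : d ≤ n)
    (hdev : (2 * N - d) ^ 2 ≤ M * d) (hb : b ≤ ε * n + 1) :
    n * p / 8 ≤ N ∧ 2 * N + 1 + b ≤ n := by
  have hs15 : s < 1 / 15 := by linarith
  have hε225 : ε < 1 / 225 := by rw [← hs2]; nlinarith
  obtain ⟨f1, f2, f3, f4, f5, f6, f7⟩ := num_facts hA hn hp hp1 hε (by linarith) H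
  have hnp0 : 0 ≤ n * p := by positivity
  have hnp : 8 * M ≤ n * p := by
    have h1 : 1000 * n ≤ (n * p) ^ 2 := by nlinarith
    refine le_of_sq_le_sq ?_ hnp0
    nlinarith
  have hεnM : M ≤ ε * n := by
    by_contra hcon
    push Not at hcon
    have h1 : (ε * n) ^ 3 < M ^ 3 := pow_lt_pow_left₀ hcon (by positivity) (by norm_num)
    have h2 : 1000 * n ^ 2 ≤ (ε * n) ^ 3 := by
      have : 1000 * n ^ 2 ≤ (ε ^ 3 * n) * n ^ 2 := by gcongr; linarith
      nlinarith
    have h3 : M ^ 4 ≤ n ^ 2 := by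
      have : (M ^ 2) ^ 2 ≤ n ^ 2 := by gcongr
      nlinarith
    have h4 : M ^ 3 ≤ M ^ 4 := pow_le_pow_right₀ hM (by norm_num)
    nlinarith
  have hd0 : 4 * M ≤ d := by linarith
  have g1 : |2 * N - d| ≤ d / 2 := abs_le_of_sq_le_sq (by nlinarith) (by linarith)
  have g2 : |2 * N - d| ≤ s * n := by
    refine abs_le_of_sq_le_sq ?_ (by positivity)
    calc _ ≤ M * d := hdev
      _ ≤ (ε * n) * n := by gcongr; linarith
      _ = _ := by rw [← hs2]; ring
  have g1' := (abs_le.1 g1).1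
  have g2' := (abs_le.1 g2).2
  refine ⟨by linarith, ?_⟩
  have hεs : ε * n ≤ s * n := by
    have : ε ≤ s := by rw [← hs2]; nlinarith
    gcongr
  have hpn : n * p ≤ n * (1 - 15 * s) := by gcongr
  have hpn' : n * (1 - 15 * s) = n - 15 * (s * n) := by ring
  linarith

lemma main_prob {n : ℕ} {G : SimpleGraph (Fin n)} {A p ε s M : ℝ} (hA : 1 ≤ A)
    (hp : 0 < p) (hp1 : p < 1) (hε : 0 < ε) (hs : 0 < s) (hs2 : s ^ 2 = ε)
    (hps : p < 1 - 15 * s)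
    (H : A ^ 2 * 1000 ≤ ε ^ 3 * n * p ^ 2)
    (hG : WeaklyBijumbled G p (A * Real.sqrt (n * p)))
    (hM : 1 ≤ M) (hnM : M ^ 2 ≤ n) :
    1 - 2 / M ≤ orientProb G {D | HasSeymourVertex D} := by
  have hs15 : s < 1 / 15 := by linarith
  have hε225 : ε < 1 / 225 := by rw [← hs2]; nlinarith
  obtain ⟨f1, f2, f3, f4, f5, f6, f7⟩ := num_facts hA (Nat.cast_nonneg n) hp hp1 hε (by linarith) H
  obtain ⟨u, hu1, hu2⟩ := good_vertex hA hp hp1 hε hs hs2 hs15 H hG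
  have hnp : 1000 ≤ n * p := by
    have : (0 : ℝ) ≤ n * p := by positivity
    nlinarith
  have hdpos : 0 < (univ.filter (G.Adj u)).card := by
    have : (0 : ℝ) < (univ.filter (G.Adj u)).card := by linarith
    exact_mod_cast this
  have hdn : ((univ.filter (G.Adj u)).card : ℝ) ≤ n := by
    have := card_le_univ (univ.filter (G.Adj u))
    rw [Fintype.card_fin] at this
    exact_mod_cast this
  have hB1 := card_bad hA hp hp1 hε (by linarith) H hG
  have hB2 := card_dev G u M hdpos
  set B1 := (univ.filter fun f : G.edgeSet → Bool => ∃ q : Finset (Fin n) × Finset (Fin n),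
      (Disjoint q.1 q.2 ∧ q.1.card = ⌈n * p / 8⌉₊ ∧ q.2.card = ⌈ε * n⌉₊) ∧
        ∀ x ∈ q.1, ∀ y ∈ q.2, ¬ bitD G f x y) with hB1d
  set B2 := (univ.filter fun f : G.edgeSet → Bool =>
      M * (univ.filter (G.Adj u)).card ≤
        (2 * ((univ.filter (bitD G f u)).card : ℝ) - (univ.filter (G.Adj u)).card) ^ 2) with hB2d
  set Gd := univ.filter fun f : G.edgeSet → Bool => bitD G f ∈ {D | HasSeymourVertex D} with hGd
  have hcov : (univ : Finset (G.edgeSet → Bool)) ⊆ (B1 ∪ B2) ∪ Gd := by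
    intro f _
    by_cases hf1 : f ∈ B1
    · simp [hf1]
    by_cases hf2 : f ∈ B2
    · simp [hf2]
    rw [mem_union]
    right
    simp only [hB1d, hB2d, mem_filter, mem_univ, true_and, not_le] at hf1 hf2
    simp only [hGd, mem_filter, mem_univ, true_and, Set.mem_ofPred_eq]
    refine ⟨u, ?_⟩
    have hb : ((⌈ε * n⌉₊ : ℕ) : ℝ) ≤ ε * n + 1 := (Nat.ceil_lt_add_one (by positivity)).le
    obtain ⟨g1, g2⟩ := final_num hA (Nat.cast_nonneg n) hp hp1 hε hs hs2 hps H hM hnM hu1 hu2 hdn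
      hf2.le hb
    refine seymour_of_good (bitD G f) u ⌈n * p / 8⌉₊ ⌈ε * n⌉₊ (Nat.ceil_le.2 g1)
      (by exact_mod_cast g2) ?_
    intro U W hd hU hW
    by_contra hcon
    push Not at hcon
    exact hf1 ⟨(U, W), ⟨hd, hU, hW⟩, hcon⟩
  have hc := card_le_card hcov
  have c1 := card_union_le (B1 ∪ B2) Gd
  have c2 := card_union_le B1 B2
  rw [card_univ, Fintype.card_fun, Fintype.card_bool] at hc
  have hc' : (2 : ℝ) ^ Fintype.card G.edgeSet ≤ B1.card + B2.card + Gd.card := by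
    have : 2 ^ Fintype.card G.edgeSet ≤ B1.card + B2.card + Gd.card := by omega
    exact_mod_cast this
  have hB1' : (B1.card : ℝ) * M ≤ 2 ^ Fintype.card G.edgeSet := by
    have h1 : (B1.card : ℝ) * 2 ^ n ≤ 2 ^ Fintype.card G.edgeSet := by exact_mod_cast hB1
    have h2 : M ≤ 2 ^ n := by
      have : (n : ℝ) ≤ 2 ^ n := by exact_mod_cast Nat.lt_two_pow_self.le
      nlinarith
    refine le_trans ?_ h1
    gcongr
  refine le_trans ?_ (orientProb_ge G _)
  have hT : (0 : ℝ) < 2 ^ Fintype.card G.edgeSet := by positivity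
  rw [le_div_iff₀ hT]
  have hM0 : 0 < M := by linarith
  have k1 : (B1.card : ℝ) ≤ 2 ^ Fintype.card G.edgeSet / M := (le_div_iff₀ hM0).2 hB1'
  have k2 : (B2.card : ℝ) ≤ 2 ^ Fintype.card G.edgeSet / M := (le_div_iff₀ hM0).2 hB2
  have k3 : (1 - 2 / M) * 2 ^ Fintype.card G.edgeSet =
    2 ^ Fintype.card G.edgeSet - 2 ^ Fintype.card G.edgeSet / M
      - 2 ^ Fintype.card G.edgeSet / M := by ring
  rw [k3]
  linarith

end Helpers

/-- There are absolute constants `C > 1` and `A` (with `0 < A ≤ e²√6`)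
such that for every `δ > 0` there is `n₀` such that for all `n ≥ n₀`, all `ε, p ∈ (0,1)`
with `ε³np² ≥ A²C` and `p < 1 − 15√ε`, and every weakly `(p, A√(np))`-bijumbled graph `G`
of order `n`, a uniformly random orientation of `G` has a Seymour vertex with probability
at least `1 − δ`. -/
theorem snc_bijumbled_random_orientation :
    ∃ C A : ℝ, 1 < C ∧ 0 < A ∧ A ≤ Real.exp 2 * Real.sqrt 6 ∧
      ∀ δ : ℝ, 0 < δ → ∃ n₀ : ℕ, ∀ n : ℕ, n₀ ≤ n →
        ∀ ε p : ℝ, ε ∈ Set.Ioo (0 : ℝ) 1 → p ∈ Set.Ioo (0 : ℝ) 1 →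
          A ^ 2 * C ≤ ε ^ 3 * n * p ^ 2 → p < 1 - 15 * Real.sqrt ε →
          ∀ G : SimpleGraph (Fin n), WeaklyBijumbled G p (A * Real.sqrt (n * p)) →
            1 - δ ≤ orientProb G {D | HasSeymourVertex D} := by
  refine ⟨1000, Real.exp 2 * Real.sqrt 6, by norm_num, by positivity, le_rfl, ?_⟩
  intro δ hδ
  refine ⟨⌈(1 + 2 / δ) ^ 2⌉₊, ?_⟩
  intro n hn ε p hε hp H hps G hG
  have hA : (1 : ℝ) ≤ Real.exp 2 * Real.sqrt 6 := by
    have h1 : (1 : ℝ) ≤ Real.exp 2 := Real.one_le_exp (by norm_num)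
    have h2 : (1 : ℝ) ≤ Real.sqrt 6 := Real.one_le_sqrt.2 (by norm_num)
    nlinarith
  have hM : (1 : ℝ) ≤ 1 + 2 / δ := by
    have : 0 < 2 / δ := by positivity
    linarith
  have h := main_prob hA hp.1 hp.2 hε.1 (Real.sqrt_pos.2 hε.1) (Real.sq_sqrt hε.1.le) hps H hG
    hM (Nat.ceil_le.1 hn)
  refine le_trans ?_ h
  have : 2 / (1 + 2 / δ) ≤ δ := by
    rw [div_le_iff₀ (by linarith)]
    have : δ * (1 + 2 / δ) = δ + 2 := by field_simp
    linarith
  linarith
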